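/- Let A ∈ ℝ^{2n×2n} be symmetric positive definite with symplectic eigenvalues 0 < d₁ ≤ … ≤ d_n, let 1 ≤ p ≤ n, and let 0 < β < d_p. Then every global minimizer X ∈ ℝ^{2n×2p} of f_β is rank-deficient, i.e. rank(X) < 2p. -/

import Mathlib

open Matrix BigOperators

noncomputable section

/-- The Poisson matrix `J_k = [[0, I],[-I, 0]]`, on index type `Fin k ⊕ Fin k`
(representing dimension `2k`). -/
def Jmat (k : ℕ) : Matrix (Fin k ⊕ Fin k) (Fin k ⊕ Fin k) ℝ :=
  Matrix.fromBlocks 0 1 (-1) 0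

/-- Squared Frobenius norm `‖M‖_F² = tr(Mᵀ M)`. -/
def frobSq {m k : Type*} [Fintype m] [Fintype k] (M : Matrix m k ℝ) : ℝ :=
  Matrix.trace (Mᵀ * M)

/-- The Frobenius norm. -/
def frobNorm {m k : Type*} [Fintype m] [Fintype k] (M : Matrix m k ℝ) : ℝ :=
  Real.sqrt (frobSq M)

/-- The trace-penalty function `f_β`. -/
def fPen (n p : ℕ) (A : Matrix (Fin n ⊕ Fin n) (Fin n ⊕ Fin n) ℝ) (β : ℝ)
    (X : Matrix (Fin n ⊕ Fin n) (Fin p ⊕ Fin p) ℝ) : ℝ :=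
  (1 / 2) * Matrix.trace (Xᵀ * A * X) + (β / 4) * frobSq (Xᵀ * Jmat n * X - Jmat p)

/-- The gradient `∇f_β(X) = AX - βJ_nX(XᵀJ_nX - J_p)`. -/
def gradPen (n p : ℕ) (A : Matrix (Fin n ⊕ Fin n) (Fin n ⊕ Fin n) ℝ) (β : ℝ)
    (X : Matrix (Fin n ⊕ Fin n) (Fin p ⊕ Fin p) ℝ) :
    Matrix (Fin n ⊕ Fin n) (Fin p ⊕ Fin p) ℝ :=
  A * X - β • (Jmat n * X * (Xᵀ * Jmat n * X - Jmat p))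

theorem Jmat_transpose (k : ℕ) : (Jmat k)ᵀ = -Jmat k := by
  simp [Jmat, Matrix.fromBlocks_transpose, Matrix.fromBlocks_neg]

theorem Jmat_mul_self (k : ℕ) : Jmat k * Jmat k = -1 := by
  simp [Jmat, Matrix.fromBlocks_multiply, ← Matrix.fromBlocks_one, Matrix.fromBlocks_neg]

theorem Jmat_mul_diagonal (k : ℕ) (d : Fin k → ℝ) :
    Jmat k * diagonal (Sum.elim d d) = diagonal (Sum.elim d d) * Jmat k := by
  simp [Jmat, ← Matrix.fromBlocks_diagonal, Matrix.fromBlocks_multiply]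

/-- A real quartic vanishing at `0` and bounded below by `0` has no linear term. -/
theorem linear_coeff_eq_zero_of_quartic_nonneg (a b c e : ℝ)
    (h : ∀ t : ℝ, 0 ≤ a * t + b * t ^ 2 + c * t ^ 3 + e * t ^ 4) : a = 0 := by
  have hd : HasDerivAt (fun t : ℝ => a * t + b * t ^ 2 + c * t ^ 3 + e * t ^ 4) a 0 := by
    have h1 := (((hasDerivAt_id (0 : ℝ)).const_mul a).add
      (((hasDerivAt_pow 2 (0 : ℝ))).const_mul b)).add ((hasDerivAt_pow 3 (0 : ℝ)).const_mul c)
    have h2 := h1.add ((hasDerivAt_pow 4 (0 : ℝ)).const_mul e)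
    exact h2.congr_deriv (by simp)
  refine IsLocalMin.hasDerivAt_eq_zero (Filter.Eventually.of_forall fun t => ?_) hd
  simpa using h t

theorem fPen_add_smul (n p : ℕ) (A : Matrix (Fin n ⊕ Fin n) (Fin n ⊕ Fin n) ℝ) (hA : Aᵀ = A)
    (β : ℝ) (X H : Matrix (Fin n ⊕ Fin n) (Fin p ⊕ Fin p) ℝ) :
    ∃ b c e : ℝ, ∀ t : ℝ, fPen n p A β (X + t • H) =
      fPen n p A β X + (trace (Hᵀ * gradPen n p A β X) * t + b * t ^ 2 + c * t ^ 3 + e * t ^ 4) := by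
  set E := Xᵀ * Jmat n * X - Jmat p with hE
  set B := Hᵀ * Jmat n * X + Xᵀ * Jmat n * H with hB
  set C := Hᵀ * Jmat n * H with hC
  have hEt : Eᵀ = -E := by
    simp only [hE, transpose_sub, transpose_mul, Jmat_transpose, transpose_transpose]
    rw [Matrix.neg_mul, Matrix.mul_neg, Matrix.mul_assoc]
    abel
  have hlinA : trace (Xᵀ * A * H) = trace (Hᵀ * (A * X)) := by
    rw [← trace_transpose]
    simp [transpose_mul, hA, Matrix.mul_assoc]
  have hlinB : trace (Eᵀ * B) = -2 * trace (Hᵀ * (Jmat n * X * E)) := by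
    have h1 : trace (E * (Hᵀ * Jmat n * X)) = trace (Hᵀ * (Jmat n * X * E)) := by
      rw [trace_mul_comm]; simp only [Matrix.mul_assoc]
    have h2 : trace (E * (Xᵀ * Jmat n * H)) = trace (Hᵀ * (Jmat n * X * E)) := by
      rw [← trace_transpose]
      simp [transpose_mul, hEt, Jmat_transpose, Matrix.mul_assoc]
    rw [hEt, hB, Matrix.neg_mul, trace_neg, Matrix.mul_add, trace_add, h1, h2]
    ring
  have hsymm : ∀ P Q : Matrix (Fin p ⊕ Fin p) (Fin p ⊕ Fin p) ℝ,
      trace (Pᵀ * Q) = trace (Qᵀ * P) := by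
    intro P Q
    rw [← trace_transpose]
    simp [transpose_mul]
  have hG : trace (Hᵀ * gradPen n p A β X) =
      trace (Hᵀ * (A * X)) - β * trace (Hᵀ * (Jmat n * X * E)) := by
    simp [gradPen, hE, Matrix.mul_sub, trace_sub, trace_smul]
  refine ⟨(1 / 2) * trace (Hᵀ * A * H) + (β / 4) * (trace (Bᵀ * B) + 2 * trace (Eᵀ * C)),
    (β / 2) * trace (Bᵀ * C), (β / 4) * trace (Cᵀ * C), fun t => ?_⟩
  have hexp : (X + t • H)ᵀ * Jmat n * (X + t • H) - Jmat p = E + t • B + (t ^ 2) • C := by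
    simp only [hE, hB, hC, transpose_add, transpose_smul, Matrix.add_mul, Matrix.mul_add,
      Matrix.smul_mul, Matrix.mul_smul, smul_smul, smul_add, pow_two]
    abel
  have hexpA : trace ((X + t • H)ᵀ * A * (X + t • H)) = trace (Xᵀ * A * X)
      + 2 * t * trace (Hᵀ * (A * X)) + t ^ 2 * trace (Hᵀ * A * H) := by
    simp only [transpose_add, transpose_smul, Matrix.add_mul, Matrix.mul_add,
      Matrix.smul_mul, Matrix.mul_smul, trace_add, trace_smul, smul_eq_mul, hlinA]
    rw [Matrix.mul_assoc Hᵀ A X]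
    ring
  have hfrob : frobSq (E + t • B + (t ^ 2) • C) = trace (Eᵀ * E) + 2 * t * trace (Eᵀ * B)
      + t ^ 2 * (trace (Bᵀ * B) + 2 * trace (Eᵀ * C)) + 2 * t ^ 3 * trace (Bᵀ * C)
      + t ^ 4 * trace (Cᵀ * C) := by
    simp only [frobSq, transpose_add, transpose_smul, Matrix.add_mul, Matrix.mul_add,
      Matrix.smul_mul, Matrix.mul_smul, trace_add, trace_smul, smul_eq_mul]
    rw [hsymm B E, hsymm C E, hsymm C B]
    ring
  rw [fPen, hexp, hexpA, hfrob, hlinB, hG, fPen, ← hE, frobSq]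
  ring

theorem gradPen_eq_zero_of_forall_le (n p : ℕ) (A : Matrix (Fin n ⊕ Fin n) (Fin n ⊕ Fin n) ℝ)
    (hA : Aᵀ = A) (β : ℝ) (X : Matrix (Fin n ⊕ Fin n) (Fin p ⊕ Fin p) ℝ)
    (hmin : ∀ Y, fPen n p A β X ≤ fPen n p A β Y) : gradPen n p A β X = 0 := by
  obtain ⟨b, c, e, h⟩ := fPen_add_smul n p A hA β X (gradPen n p A β X)
  have h0 : trace ((gradPen n p A β X)ᵀ * gradPen n p A β X) = 0 :=
    linear_coeff_eq_zero_of_quartic_nonneg _ b c e fun t => by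
      have := hmin (X + t • gradPen n p A β X)
      rw [h t] at this
      linarith
  rw [← conjTranspose_eq_transpose_of_trivial] at h0
  exact trace_conjTranspose_mul_self_eq_zero_iff.mp h0

/-- At a stationary point, `1 + E²` is positive semidefinite, where `E = XᵀJX - J` is skew. -/
theorem posSemidef_one_sub_of_gradPen_eq_zero (n p : ℕ)
    (A : Matrix (Fin n ⊕ Fin n) (Fin n ⊕ Fin n) ℝ) (hA : A.PosSemidef) (β : ℝ) (hβ : 0 < β)
    (X : Matrix (Fin n ⊕ Fin n) (Fin p ⊕ Fin p) ℝ) (hX : gradPen n p A β X = 0) :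
    (1 + (Xᵀ * Jmat n * X - Jmat p) * (Xᵀ * Jmat n * X - Jmat p)).PosSemidef := by
  have hAt : Aᵀ = A := by
    rw [← conjTranspose_eq_transpose_of_trivial]; exact hA.1
  set W := Xᵀ * Jmat n * X with hW
  have hWt : Wᵀ = -W := by
    simp [hW, transpose_mul, Jmat_transpose, Matrix.mul_assoc]
  have hQ : Xᵀ * A * X = β • (W * W - W * Jmat p) := by
    have h1 : A * X = β • (Jmat n * X * (W - Jmat p)) := sub_eq_zero.mp hX
    rw [Matrix.mul_assoc, h1, Matrix.mul_smul, ← Matrix.mul_sub, hW]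
    simp only [Matrix.mul_assoc]
  have hcomm : W * Jmat p = Jmat p * W := by
    have h1 : (Xᵀ * A * X)ᵀ = Xᵀ * A * X := by
      simp [transpose_mul, hAt, Matrix.mul_assoc]
    rw [hQ, transpose_smul, transpose_sub, transpose_mul W, transpose_mul W, hWt,
      Jmat_transpose] at h1
    have h2 := smul_right_injective _ hβ.ne' h1
    simpa using h2.symm
  have hP : 1 + (W - Jmat p) * (W - Jmat p) = (2 / β) • (Xᴴ * A * X) + Wᴴ * W := by
    rw [conjTranspose_eq_transpose_of_trivial, conjTranspose_eq_transpose_of_trivial, hQ, hWt,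
      smul_smul, div_mul_cancel₀ _ hβ.ne', two_smul, Matrix.sub_mul, Matrix.mul_sub,
      Matrix.mul_sub, Jmat_mul_self, ← hcomm, Matrix.neg_mul]
    abel
  rw [hP]
  exact ((hA.conjTranspose_mul_mul_same X).smul (by positivity)).add
    (posSemidef_conjTranspose_mul_self W)

/-- If `diag(δ)² Y = β² Y N` with `1 - N ⪰ 0`, then row `i` of `Y` vanishes whenever `β² < δ i ²`. -/
theorem row_eq_zero_of_diagonal_sq_mul_eq {m k : Type*} [Fintype m] [Fintype k] [DecidableEq m]
    [DecidableEq k] (δ : m → ℝ) (β : ℝ) (Y : Matrix m k ℝ) (N : Matrix k k ℝ)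
    (hN : (1 - N).PosSemidef) (h : diagonal δ * diagonal δ * Y = β ^ 2 • (Y * N))
    (i : m) (hi : β ^ 2 < δ i ^ 2) (j : k) : Y i j = 0 := by
  have h1 : 0 ≤ (Y * (1 - N) * Yᴴ : Matrix m m ℝ) i i := (hN.mul_mul_conjTranspose_same Y).diag_nonneg
  have h2 : β ^ 2 • (Y * (1 - N) * Yᴴ) = β ^ 2 • (Y * Yᴴ) - diagonal δ * diagonal δ * (Y * Yᴴ) := by
    rw [← Matrix.mul_assoc, h, Matrix.mul_sub, Matrix.mul_one, Matrix.sub_mul, smul_sub,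
      Matrix.smul_mul]
  have h3 := congrFun (congrFun h2 i) i
  rw [diagonal_mul_diagonal] at h3
  simp only [Matrix.smul_apply, Matrix.sub_apply, diagonal_mul, smul_eq_mul] at h3
  have h4 : (Y * Yᴴ : Matrix m m ℝ) i i = ∑ l, Y i l ^ 2 := by
    simp [Matrix.mul_apply, pow_two]
  have h5 : 0 ≤ ∑ l, Y i l ^ 2 := Finset.sum_nonneg fun l _ => sq_nonneg _
  rw [h4] at h3
  have h6 : ∑ l, Y i l ^ 2 = 0 := by
    have := mul_nonneg (sq_nonneg β) h1
    nlinarith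
  have h7 := (Finset.sum_eq_zero_iff_of_nonneg fun l _ => sq_nonneg (Y i l)).mp h6 j
    (Finset.mem_univ j)
  exact pow_eq_zero_iff two_ne_zero |>.mp h7

/-- The rank is at most the size of any set of rows outside of which the matrix vanishes. -/
theorem rank_le_card_of_row_eq_zero {m k : Type*} [Fintype m] [Fintype k] [DecidableEq m]
    (Y : Matrix m k ℝ) (s : Finset m) (h : ∀ i ∉ s, ∀ j, Y i j = 0) : Y.rank ≤ s.card := by
  have hY : Y = diagonal (fun i => if i ∈ s then (1 : ℝ) else 0) * Y := by
    ext i j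
    rw [diagonal_mul]
    split_ifs with hi
    · simp
    · simp [h i hi j]
  rw [hY]
  refine (rank_mul_le_left _ _).trans ?_
  rw [rank_diagonal]
  simp

theorem stmt15 (n p : ℕ) (hp : 1 ≤ p) (hpn : p ≤ n)
    (A : Matrix (Fin n ⊕ Fin n) (Fin n ⊕ Fin n) ℝ) (hA : A.PosDef)
    (d : Fin n → ℝ) (hmono : Monotone d) (hdpos : ∀ i, 0 < d i)
    (S₀ : Matrix (Fin n ⊕ Fin n) (Fin n ⊕ Fin n) ℝ)
    (hS₀symp : S₀ᵀ * Jmat n * S₀ = Jmat n)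
    (hS₀diag : S₀ᵀ * A * S₀ = Matrix.diagonal (Sum.elim d d))
    (β : ℝ) (hβpos : 0 < β) (hβ : β < d ⟨p - 1, by omega⟩)
    (X : Matrix (Fin n ⊕ Fin n) (Fin p ⊕ Fin p) ℝ)
    (hmin : ∀ Y, fPen n p A β X ≤ fPen n p A β Y) :
    X.rank < 2 * p := by
  have hAt : Aᵀ = A := by
    rw [← conjTranspose_eq_transpose_of_trivial]; exact hA.1
  have hgrad := gradPen_eq_zero_of_forall_le n p A hAt β X hmin
  have hpsd := posSemidef_one_sub_of_gradPen_eq_zero n p A hA.posSemidef β hβpos X hgrad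
  set E := Xᵀ * Jmat n * X - Jmat p with hE
  set D := diagonal (Sum.elim d d) with hD
  have hAX : A * X = β • (Jmat n * X * E) := sub_eq_zero.mp hgrad
  set T := -(Jmat n * S₀ᵀ * Jmat n) with hT
  have hTS : T * S₀ = 1 := by
    rw [hT, Matrix.neg_mul, Matrix.mul_assoc, Matrix.mul_assoc, ← Matrix.mul_assoc S₀ᵀ, hS₀symp,
      Jmat_mul_self, neg_neg]
  have hST : S₀ * T = 1 := mul_eq_one_comm.mp hTS
  set Y := T * X with hY
  have hXY : X = S₀ * Y := by rw [hY, ← Matrix.mul_assoc, hST, Matrix.one_mul]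
  have hTJ : T * Jmat n = Jmat n * S₀ᵀ := by
    rw [hT, Matrix.neg_mul, Matrix.mul_assoc, Jmat_mul_self]
    simp
  have hJDY : Jmat n * D * Y = -β • (Y * E) := by
    have h1 : D * Y = S₀ᵀ * (A * X) := by
      rw [← hS₀diag, hXY]
      simp only [Matrix.mul_assoc]
    rw [Matrix.mul_assoc, h1, ← Matrix.mul_assoc, ← hTJ, hAX, Matrix.mul_smul, Matrix.mul_assoc T,
      ← Matrix.mul_assoc (Jmat n), ← Matrix.mul_assoc (Jmat n), Jmat_mul_self, hY]
    simp [Matrix.mul_assoc]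
  have hDY : D * D * Y = β ^ 2 • (Y * -(E * E)) := by
    have h1 : Jmat n * D * (Jmat n * D * Y) = β ^ 2 • (Y * (E * E)) := by
      rw [hJDY, Matrix.mul_smul, ← Matrix.mul_assoc, hJDY, Matrix.smul_mul, smul_smul,
        Matrix.mul_assoc]
      ring_nf
    have h2 : Jmat n * D * (Jmat n * D * Y) = -(D * D * Y) := by
      have hJD : Jmat n * D = D * Jmat n := Jmat_mul_diagonal n d
      calc Jmat n * D * (Jmat n * D * Y) = Jmat n * (D * Jmat n) * (D * Y) := by
            simp only [Matrix.mul_assoc]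
        _ = -(D * D * Y) := by
            rw [← hJD, ← Matrix.mul_assoc (Jmat n), Jmat_mul_self]
            simp [Matrix.mul_assoc]
    rw [Matrix.mul_neg, smul_neg, ← h1, h2, neg_neg]
  have hrow := row_eq_zero_of_diagonal_sq_mul_eq (Sum.elim d d) β Y (-(E * E))
    (by rwa [sub_neg_eq_add]) hDY
  have hhigh : ∀ i : Fin n, p - 1 ≤ (i : ℕ) → β ^ 2 < d i ^ 2 := fun i hi => by
    have : d ⟨p - 1, by omega⟩ ≤ d i := hmono (Fin.le_def.mpr hi)
    exact pow_lt_pow_left₀ (hβ.trans_le this) hβpos.le two_ne_zero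
  have hrank : Y.rank ≤ ((Finset.Iio (⟨p - 1, by omega⟩ : Fin n)).disjSum
      (Finset.Iio (⟨p - 1, by omega⟩ : Fin n))).card := by
    refine rank_le_card_of_row_eq_zero Y _ fun i hi j => hrow i ?_ j
    rcases i with i | i <;>
    · simp only [Finset.inl_mem_disjSum, Finset.inr_mem_disjSum, Finset.mem_Iio, not_lt] at hi
      exact hhigh i (Fin.le_def.mp hi)
  rw [Finset.card_disjSum, Fin.card_Iio] at hrank
  have hle : X.rank ≤ Y.rank := by
    rw [hXY]
    exact rank_mul_le_right _ _
  simp only at hrank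
  omega
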